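/- (Scaling axiom for τ̂_x: characterization of maximal correlation.) For any two non-strict incomplete rankings a, b of n objects with n̄(a,b) ≥ 2, τ̂_x(a, b) = 1 if and only if the projections of a and b onto V_a ∩ V_b express identical pairwise preferences, i.e., M(a)_{ij} = M(b)_{ij} for all i, j ∈ V_a ∩ V_b. -/

import Mathlib

open Finset

/-- A non-strict incomplete ranking of `n` objects: object `i` is ranked iff `a i ≠ none`. -/
abbrev Ranking (n : ℕ) := Fin n → Option ℕ

/-- The set of objects ranked by `a`. -/
def ranked {n : ℕ} (a : Ranking n) : Finset (Fin n) :=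
  Finset.univ.filter fun i => (a i).isSome

/-- The ranking-matrix of `a`. -/
def rmat {n : ℕ} (a : Ranking n) (i j : Fin n) : ℤ :=
  if i = j then 0
  else
    match a i, a j with
    | some x, some y => if x ≤ y then 1 else -1
    | _, _ => 0

/-- `n̄(a,b)`: the number of objects ranked by both `a` and `b`. -/
def nbar {n : ℕ} (a b : Ranking n) : ℕ := (ranked a ∩ ranked b).card

/-- The scaled Kendall tau-extended correlation coefficient `τ̂ₓ(a,b)`. -/
def tauHat {n : ℕ} (a b : Ranking n) : ℚ :=
  (∑ i : Fin n, ∑ j : Fin n, ((rmat a i j * rmat b i j : ℤ) : ℚ)) /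
    ((nbar a b : ℚ) * ((nbar a b : ℚ) - 1))

/-- The Kendall tau-extended correlation coefficient `τₓ(a,b)` (extended ranking-matrix). -/
def tauX {n : ℕ} (a b : Ranking n) : ℚ :=
  (∑ i : Fin n, ∑ j : Fin n, ((rmat a i j * rmat b i j : ℤ) : ℚ)) /
    ((n : ℚ) * ((n : ℚ) - 1))

/-- The projected Kemeny–Snell distance (minimum distance unit 1/2). -/
def dPKS {n : ℕ} (a b : Ranking n) : ℚ :=
  (1/4) * ∑ i ∈ ranked a ∩ ranked b, ∑ j ∈ ranked a ∩ ranked b,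
    ((|(((a i).getD 0 : ℤ) - ((a j).getD 0 : ℤ)).sign -
       (((b i).getD 0 : ℤ) - ((b j).getD 0 : ℤ)).sign| : ℤ) : ℚ)

/-- The normalized projected Kemeny–Snell distance. -/
def dNPKS {n : ℕ} (a b : Ranking n) : ℚ :=
  if 2 ≤ nbar a b then
    dPKS a b / ((nbar a b : ℚ) * ((nbar a b : ℚ) - 1) / 2)
  else 0

/-- The projection of `a` onto the subset `S` of objects. -/
def proj {n : ℕ} (a : Ranking n) (S : Finset (Fin n)) : Ranking n :=
  fun i => if i ∈ S then a i else none

theorem mem_ranked {n : ℕ} {a : Ranking n} {i : Fin n} : i ∈ ranked a ↔ (a i).isSome := by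
  simp [ranked]

theorem rmat_self {n : ℕ} (a : Ranking n) (i : Fin n) : rmat a i i = 0 := by
  simp [rmat]

theorem rmat_eq_zero_of_notMem_left {n : ℕ} {a : Ranking n} {i : Fin n} (j : Fin n)
    (hi : i ∉ ranked a) : rmat a i j = 0 := by
  rw [mem_ranked, Option.not_isSome_iff_eq_none] at hi
  simp [rmat, hi]

theorem rmat_eq_zero_of_notMem_right {n : ℕ} {a : Ranking n} (i : Fin n) {j : Fin n}
    (hj : j ∉ ranked a) : rmat a i j = 0 := by
  rw [mem_ranked, Option.not_isSome_iff_eq_none] at hj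
  simp [rmat, hj]

theorem rmat_eq_one_or_neg_one {n : ℕ} {a : Ranking n} {i j : Fin n} (hij : i ≠ j)
    (hi : i ∈ ranked a) (hj : j ∈ ranked a) : rmat a i j = 1 ∨ rmat a i j = -1 := by
  obtain ⟨x, hx⟩ := Option.isSome_iff_exists.1 (mem_ranked.1 hi)
  obtain ⟨y, hy⟩ := Option.isSome_iff_exists.1 (mem_ranked.1 hj)
  simp only [rmat, hij, hx, hy, if_false]
  exact ite_eq_or_eq _ _ _

/-- Only pairs of distinct, commonly ranked objects contribute to the correlation sum. -/
theorem sum_rmat_mul_rmat {n : ℕ} (a b : Ranking n) :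
    ∑ i, ∑ j, rmat a i j * rmat b i j =
      ∑ p ∈ (ranked a ∩ ranked b).offDiag, rmat a p.1 p.2 * rmat b p.1 p.2 := by
  rw [← Fintype.sum_prod_type' (f := fun i j => rmat a i j * rmat b i j)]
  symm
  refine sum_subset (subset_univ _) ?_
  rintro ⟨i, j⟩ - hp
  by_contra hne
  refine hp (mem_offDiag.2 ⟨mem_inter.2 ⟨?_, ?_⟩, mem_inter.2 ⟨?_, ?_⟩, ?_⟩)
  · exact by_contra fun hi => hne (by simp [rmat_eq_zero_of_notMem_left j hi])
  · exact by_contra fun hi => hne (by simp [rmat_eq_zero_of_notMem_left j hi])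
  · exact by_contra fun hj => hne (by simp [rmat_eq_zero_of_notMem_right i hj])
  · exact by_contra fun hj => hne (by simp [rmat_eq_zero_of_notMem_right i hj])
  · intro hij
    exact hne (by simp [show i = j from hij, rmat_self])

/-- The correlation sum attains the number of contributing pairs iff the preferences agree. -/
theorem sum_rmat_mul_rmat_eq_card_iff {n : ℕ} (a b : Ranking n) :
    ∑ i, ∑ j, rmat a i j * rmat b i j = ((ranked a ∩ ranked b).offDiag.card : ℤ) ↔
      ∀ i j, i ∈ ranked a ∩ ranked b → j ∈ ranked a ∩ ranked b →
        rmat a i j = rmat b i j := by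
  have key : ∀ p ∈ (ranked a ∩ ranked b).offDiag,
      rmat a p.1 p.2 * rmat b p.1 p.2 ≤ 1 ∧
        (rmat a p.1 p.2 * rmat b p.1 p.2 = 1 ↔ rmat a p.1 p.2 = rmat b p.1 p.2) := by
    intro p hp
    obtain ⟨hi, hj, hij⟩ := mem_offDiag.1 hp
    rw [mem_inter] at hi hj
    rcases rmat_eq_one_or_neg_one hij hi.1 hj.1 with ha | ha <;>
      rcases rmat_eq_one_or_neg_one hij hi.2 hj.2 with hb | hb <;> simp [ha, hb]
  rw [sum_rmat_mul_rmat, card_eq_sum_ones, Nat.cast_sum, Nat.cast_one,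
    sum_eq_sum_iff_of_le fun p hp => (key p hp).1]
  constructor
  · intro heq i j hi hj
    by_cases hij : i = j
    · rw [hij, rmat_self, rmat_self]
    · have hp : (i, j) ∈ (ranked a ∩ ranked b).offDiag := mem_offDiag.2 ⟨hi, hj, hij⟩
      exact (key _ hp).2.1 (heq _ hp)
  · intro heq p hp
    obtain ⟨hi, hj, -⟩ := mem_offDiag.1 hp
    exact (key p hp).2.2 (heq _ _ hi hj)

/-- Axiom 6 (Scaling), maximal value: τ̂ₓ(a,b) = 1 iff the projections of `a` and `b`
onto the commonly ranked objects express identical pairwise preferences. -/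
theorem tauHat_eq_one_iff (n : ℕ) (a b : Ranking n) (h : 2 ≤ nbar a b) :
    tauHat a b = 1 ↔
      ∀ i j, i ∈ ranked a ∩ ranked b → j ∈ ranked a ∩ ranked b →
        rmat a i j = rmat b i j := by
  have hn : (2 : ℚ) ≤ nbar a b := by exact_mod_cast h
  have hpos : (nbar a b : ℚ) * ((nbar a b : ℚ) - 1) ≠ 0 :=
    (mul_pos (by linarith) (by linarith)).ne'
  have hcard : (nbar a b : ℚ) * ((nbar a b : ℚ) - 1) =
      (((ranked a ∩ ranked b).offDiag.card : ℤ) : ℚ) := by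
    rw [offDiag_card, Int.cast_natCast, Nat.cast_sub (Nat.le_mul_self _), Nat.cast_mul, nbar]
    ring
  rw [tauHat, div_eq_one_iff_eq hpos, hcard, ← sum_rmat_mul_rmat_eq_card_iff]
  exact_mod_cast Iff.rfl
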